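/- arXiv:2604.07243 — 6 statements merged into one kernel-verified Lean document; each statement's English description precedes it below -/
import Mathlib

section
/- Let R be a commutative ring in which 2 is invertible, and let E(A₁,R) be the elementary adjoint Chevalley group of type A₁ over R, i.e. the subgroup of GL₃(R) generated by all matrices x₊(t) and x₋(t) for t ∈ R. Then every class-preserving endomorphism of E(A₁,R) is inner: if φ : E(A₁,R) → E(A₁,R) is a group homomorphism such that for every g ∈ E(A₁,R) the element φ(g) is conjugate to g in E(A₁,R), then there exists y ∈ E(A₁,R) with φ(g) = y·g·y⁻¹ for all g ∈ E(A₁,R). -/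
open Matrix

/-- The positive root element `x₊(t)` of the adjoint Chevalley group of type A₁
in its standard 3-dimensional adjoint representation. -/
def xPlus {R : Type*} [CommRing R] (t : R) : Matrix (Fin 3) (Fin 3) R :=
  !![1, t^2, 2*t; 0, 1, 0; 0, t, 1]

/-- The negative root element `x₋(t)`. -/
def xMinus {R : Type*} [CommRing R] (t : R) : Matrix (Fin 3) (Fin 3) R :=
  !![1, 0, 0; t^2, 1, 2*t; t, 0, 1]

/-- The elementary adjoint Chevalley group `E(A₁,R)`: the subgroup of `GL₃(R)`
generated by all `x₊(t)` and `x₋(t)`, `t ∈ R`. -/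
def ElemA1 (R : Type*) [CommRing R] : Subgroup (GL (Fin 3) R) :=
  Subgroup.closure {g : GL (Fin 3) R | ∃ t : R,
    (g : Matrix (Fin 3) (Fin 3) R) = xPlus t ∨
    (g : Matrix (Fin 3) (Fin 3) R) = xMinus t}

namespace ElemA1

variable {R : Type*} [CommRing R]

/-- The matrix of `Ad [[a, b], [c, d]]` in the basis in which `xPlus` and `xMinus` are written. -/
def adMatrix (a b c d : R) : Matrix (Fin 3) (Fin 3) R :=
  !![a^2, b^2, 2*a*b; c^2, d^2, 2*c*d; a*c, b*d, a*d+b*c]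

theorem adMatrix_mul (a b c d a' b' c' d' : R) :
    adMatrix a b c d * adMatrix a' b' c' d' =
      adMatrix (a*a'+b*c') (a*b'+b*d') (c*a'+d*c') (c*b'+d*d') := by
  ext i j
  fin_cases i <;> fin_cases j <;> simp [adMatrix, Matrix.mul_apply, Fin.sum_univ_three] <;> ring

theorem adMatrix_one : adMatrix (1 : R) 0 0 1 = 1 := by
  ext i j
  fin_cases i <;> fin_cases j <;> simp [adMatrix]

theorem xPlus_eq_adMatrix (t : R) : xPlus t = adMatrix 1 t 0 1 := by
  simp [xPlus, adMatrix]

theorem xMinus_eq_adMatrix (t : R) : xMinus t = adMatrix 1 0 t 1 := by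
  simp [xMinus, adMatrix]

theorem trace_adMatrix {a b c d : R} (h : a * d - b * c = 1) :
    (adMatrix a b c d).trace = (a + d)^2 - 1 := by
  simp only [adMatrix, Matrix.trace_fin_three, Matrix.of_apply, Matrix.cons_val]
  linear_combination -h

theorem adMatrix_mul_adjugate {a b c d : R} (h : a * d - b * c = 1) :
    adMatrix a b c d * adMatrix d (-b) (-c) a = 1 := by
  rw [adMatrix_mul, ← adMatrix_one]
  congr 1
  · linear_combination h
  · ring
  · ring
  · linear_combination h

theorem coe_inv_eq_adMatrix {g : GL (Fin 3) R} {a b c d : R} (h : a * d - b * c = 1)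
    (hg : (g : Matrix (Fin 3) (Fin 3) R) = adMatrix a b c d) :
    ((g⁻¹ : GL (Fin 3) R) : Matrix (Fin 3) (Fin 3) R) = adMatrix d (-b) (-c) a := by
  rw [Units.inv_eq_of_mul_eq_one_right (hg ▸ adMatrix_mul_adjugate h)]

theorem exists_eq_adMatrix {g : GL (Fin 3) R} (hg : g ∈ ElemA1 R) :
    ∃ a b c d : R, a * d - b * c = 1 ∧
      (g : Matrix (Fin 3) (Fin 3) R) = adMatrix a b c d := by
  induction hg using Subgroup.closure_induction with
  | mem x hx =>
    obtain ⟨t, ht | ht⟩ := hx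
    · exact ⟨1, t, 0, 1, by ring, by rw [ht, xPlus_eq_adMatrix]⟩
    · exact ⟨1, 0, t, 1, by ring, by rw [ht, xMinus_eq_adMatrix]⟩
  | one => exact ⟨1, 0, 0, 1, by ring, by rw [adMatrix_one]; rfl⟩
  | mul x y _ _ hx hy =>
    obtain ⟨a, b, c, d, h, hx⟩ := hx
    obtain ⟨a', b', c', d', h', hy⟩ := hy
    refine ⟨_, _, _, _, ?_, by rw [Units.val_mul, hx, hy, adMatrix_mul]⟩
    linear_combination (a' * d' - b' * c') * h + h'
  | inv x _ hx =>
    obtain ⟨a, b, c, d, h, hx⟩ := hx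
    exact ⟨d, -b, -c, a, by linear_combination h, coe_inv_eq_adMatrix h hx⟩

/-- The underlying 3×3 matrix of an element of `ElemA1 R`. -/
def toMatrix (g : ElemA1 R) : Matrix (Fin 3) (Fin 3) R := ((g : GL (Fin 3) R) : Matrix _ _ R)

theorem toMatrix_mul (g h : ElemA1 R) : toMatrix (g * h) = toMatrix g * toMatrix h := rfl

theorem toMatrix_injective : Function.Injective (toMatrix (R := R)) :=
  fun _ _ h => Subtype.ext (Units.ext h)

theorem toMatrix_inv {g : ElemA1 R} {a b c d : R} (h : a * d - b * c = 1)
    (hg : toMatrix g = adMatrix a b c d) : toMatrix g⁻¹ = adMatrix d (-b) (-c) a :=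
  coe_inv_eq_adMatrix h hg

theorem trace_toMatrix_conj (y g : ElemA1 R) :
    (toMatrix (y * g * y⁻¹)).trace = (toMatrix g).trace := by
  rw [toMatrix_mul, Matrix.trace_mul_comm, ← toMatrix_mul, ← mul_assoc, inv_mul_cancel, one_mul]

/-- The element `x₊(t)` of `ElemA1 R`. -/
def posRoot (t : R) : ElemA1 R :=
  ⟨⟨xPlus t, xPlus (-t),
    by
      simpa [xPlus_eq_adMatrix] using adMatrix_mul_adjugate (a := 1) (b := t) (c := 0) (d := 1)
        (by ring),
    by
      simpa [xPlus_eq_adMatrix] using adMatrix_mul_adjugate (a := 1) (b := -t) (c := 0) (d := 1)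
        (by ring)⟩,
    Subgroup.subset_closure ⟨t, Or.inl rfl⟩⟩

/-- The element `x₋(t)` of `ElemA1 R`. -/
def negRoot (t : R) : ElemA1 R :=
  ⟨⟨xMinus t, xMinus (-t),
    by
      simpa [xMinus_eq_adMatrix] using adMatrix_mul_adjugate (a := 1) (b := 0) (c := t) (d := 1)
        (by ring),
    by
      simpa [xMinus_eq_adMatrix] using adMatrix_mul_adjugate (a := 1) (b := 0) (c := -t) (d := 1)
        (by ring)⟩,
    Subgroup.subset_closure ⟨t, Or.inr rfl⟩⟩

theorem toMatrix_posRoot (t : R) : toMatrix (posRoot t) = adMatrix 1 t 0 1 :=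
  xPlus_eq_adMatrix t

theorem toMatrix_negRoot (t : R) : toMatrix (negRoot t) = adMatrix 1 0 t 1 :=
  xMinus_eq_adMatrix t

theorem posRoot_mul (s t : R) : posRoot s * posRoot t = posRoot (s + t) := by
  apply toMatrix_injective
  rw [toMatrix_mul, toMatrix_posRoot, toMatrix_posRoot, toMatrix_posRoot, adMatrix_mul]
  congr 1 <;> ring

theorem negRoot_mul (s t : R) : negRoot s * negRoot t = negRoot (s + t) := by
  apply toMatrix_injective
  rw [toMatrix_mul, toMatrix_negRoot, toMatrix_negRoot, toMatrix_negRoot, adMatrix_mul]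
  congr 1 <;> ring

theorem inv_posRoot (t : R) : (posRoot t)⁻¹ = posRoot (-t) :=
  Subtype.ext (Units.ext rfl)

theorem inv_negRoot (t : R) : (negRoot t)⁻¹ = negRoot (-t) :=
  Subtype.ext (Units.ext rfl)

theorem trace_posRoot_mul_negRoot (s t : R) :
    (toMatrix (posRoot s * negRoot t)).trace = (2 + s * t)^2 - 1 := by
  rw [toMatrix_mul, toMatrix_posRoot, toMatrix_negRoot, adMatrix_mul,
    trace_adMatrix (by ring)]
  ring

theorem exists_eq_posRoot_of_commute (h2 : IsUnit (2 : R)) {g : ElemA1 R}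
    (hg : g * posRoot 1 = posRoot 1 * g) : ∃ t, g = posRoot t := by
  obtain ⟨a, b, c, d, h, hm⟩ := exists_eq_adMatrix g.2
  change toMatrix g = _ at hm
  have e := congrArg toMatrix hg
  rw [toMatrix_mul, toMatrix_mul, toMatrix_posRoot, hm, adMatrix_mul, adMatrix_mul] at e
  have e20 := congrFun (congrFun e 2) 0
  have e00 := congrFun (congrFun e 0) 0
  have e02 := congrFun (congrFun e 0) 2
  simp [adMatrix] at e20 e00 e02
  have hcc : c * c = 0 := by linear_combination -e20
  have hac : a * c = 0 := h2.mul_left_cancel (by linear_combination -e00 - hcc)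
  have hc : c = 0 := by linear_combination -c * h - b * hcc + d * hac
  subst hc
  have had : a * d = a * a := h2.mul_left_cancel (by linear_combination -e02)
  have haa : a * a = 1 := by linear_combination h - had
  have hda : d = a := by linear_combination a * had - (d - a) * haa
  refine ⟨a * b, toMatrix_injective ?_⟩
  rw [hm, toMatrix_posRoot, hda]
  ext i j
  fin_cases i <;> fin_cases j <;> simp [adMatrix] <;> grind

theorem exists_eq_negRoot_of_commute (h2 : IsUnit (2 : R)) {g : ElemA1 R}
    (hg : g * negRoot 1 = negRoot 1 * g) : ∃ t, g = negRoot t := by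
  obtain ⟨a, b, c, d, h, hm⟩ := exists_eq_adMatrix g.2
  change toMatrix g = _ at hm
  have e := congrArg toMatrix hg
  rw [toMatrix_mul, toMatrix_mul, toMatrix_negRoot, hm, adMatrix_mul, adMatrix_mul] at e
  have e21 := congrFun (congrFun e 2) 1
  have e11 := congrFun (congrFun e 1) 1
  have e12 := congrFun (congrFun e 1) 2
  simp [adMatrix] at e21 e11 e12
  have hbb : b * b = 0 := by linear_combination -e21
  have hbd : b * d = 0 := h2.mul_left_cancel (by linear_combination -e11 - hbb)
  have hb : b = 0 := by linear_combination -b * h - c * hbb + a * hbd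
  subst hb
  have had : a * d = d * d := h2.mul_left_cancel (by linear_combination -e12)
  have hdd : d * d = 1 := by linear_combination h - had
  have hda : a = d := by linear_combination d * had - (a - d) * hdd
  refine ⟨d * c, toMatrix_injective ?_⟩
  rw [hm, toMatrix_negRoot, hda]
  ext i j
  fin_cases i <;> fin_cases j <;> simp [adMatrix] <;> grind

theorem eq_of_sq_two_add_eq (h2 : IsUnit (2 : R)) {s t : R}
    (hpos : (2 + s)^2 = (2 + t)^2) (hneg : (2 - s)^2 = (2 - t)^2) : s = t := by
  refine (h2.pow 3).mul_left_cancel ?_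
  linear_combination hpos - hneg

/-- An endomorphism of `ElemA1 R` preserving traces and fixing `x₊(1)` and `x₋(1)` is trivial. -/
theorem apply_eq_self_of_trace (h2 : IsUnit (2 : R)) (φ : ElemA1 R →* ElemA1 R)
    (htr : ∀ g, (toMatrix (φ g)).trace = (toMatrix g).trace)
    (hp : φ (posRoot 1) = posRoot 1) (hn : φ (negRoot 1) = negRoot 1) (g : ElemA1 R) :
    φ g = g := by
  have hp' : φ (posRoot (-1)) = posRoot (-1) := by rw [← inv_posRoot, map_inv, hp]
  have hn' : φ (negRoot (-1)) = negRoot (-1) := by rw [← inv_negRoot, map_inv, hn]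
  have hpos (t : R) : φ (posRoot t) = posRoot t := by
    obtain ⟨s, hs⟩ := exists_eq_posRoot_of_commute h2 (g := φ (posRoot t)) (by
      rw [← hp, ← map_mul, ← map_mul, posRoot_mul, posRoot_mul, add_comm])
    have e := htr (posRoot t * negRoot 1)
    have e' := htr (posRoot t * negRoot (-1))
    rw [map_mul, hs, hn, trace_posRoot_mul_negRoot, trace_posRoot_mul_negRoot] at e
    rw [map_mul, hs, hn', trace_posRoot_mul_negRoot, trace_posRoot_mul_negRoot] at e'
    rw [hs, eq_of_sq_two_add_eq h2 (s := s) (t := t) (by linear_combination e)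
      (by linear_combination e')]
  have hneg (t : R) : φ (negRoot t) = negRoot t := by
    obtain ⟨s, hs⟩ := exists_eq_negRoot_of_commute h2 (g := φ (negRoot t)) (by
      rw [← hn, ← map_mul, ← map_mul, negRoot_mul, negRoot_mul, add_comm])
    have e := htr (posRoot 1 * negRoot t)
    have e' := htr (posRoot (-1) * negRoot t)
    rw [map_mul, hs, hp, trace_posRoot_mul_negRoot, trace_posRoot_mul_negRoot] at e
    rw [map_mul, hs, hp', trace_posRoot_mul_negRoot, trace_posRoot_mul_negRoot] at e'
    rw [hs, eq_of_sq_two_add_eq h2 (s := s) (t := t) (by linear_combination e)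
      (by linear_combination e')]
  obtain ⟨g, hg⟩ := g
  induction hg using Subgroup.closure_induction with
  | mem x hx =>
    obtain ⟨t, ht | ht⟩ := hx
    · obtain rfl : x = posRoot t := Units.ext ht
      exact hpos t
    · obtain rfl : x = negRoot t := Units.ext ht
      exact hneg t
  | one => exact map_one φ
  | mul x y hx hy ihx ihy =>
    exact (map_mul φ ⟨x, hx⟩ ⟨y, hy⟩).trans (congrArg₂ (· * ·) ihx ihy)
  | inv x hx ih => exact (map_inv φ ⟨x, hx⟩).trans (congrArg (·⁻¹) ih)

theorem trace_posRoot_mul_conj_negRoot {y : ElemA1 R} {a b c d : R} (h : a * d - b * c = 1)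
    (hy : toMatrix y = adMatrix a b c d) (t : R) :
    (toMatrix (posRoot 1 * (y * negRoot t * y⁻¹))).trace = (2 + t * d^2)^2 - 1 := by
  rw [toMatrix_mul, toMatrix_mul, toMatrix_mul, toMatrix_posRoot, toMatrix_negRoot,
    toMatrix_inv h hy, hy, adMatrix_mul, adMatrix_mul, adMatrix_mul, trace_adMatrix]
  · congr 2
    linear_combination 2 * h
  · linear_combination (a * d - b * c + 1) * h

/-- If the trace of `x₊(1) · y x₋(±1) y⁻¹` does not depend on `y`, then `y x₋(1) y⁻¹` is already a
conjugate of `x₋(1)` by an element `x₊(t)`. -/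
theorem exists_conj_negRoot_eq (h2 : IsUnit (2 : R)) (y : ElemA1 R)
    (htr : ∀ s : R, s = 1 ∨ s = -1 → (toMatrix (posRoot 1 * (y * negRoot s * y⁻¹))).trace =
      (toMatrix (posRoot 1 * negRoot s)).trace) :
    ∃ t : R, y * negRoot 1 * y⁻¹ = posRoot t * negRoot 1 * (posRoot t)⁻¹ := by
  obtain ⟨a, b, c, d, h, hy⟩ := exists_eq_adMatrix y.2
  change toMatrix y = _ at hy
  have e := htr 1 (Or.inl rfl)
  have e' := htr (-1) (Or.inr rfl)
  rw [trace_posRoot_mul_conj_negRoot h hy, trace_posRoot_mul_negRoot] at e e'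
  have hd : d^2 = 1 := eq_of_sq_two_add_eq h2 (by linear_combination e) (by linear_combination e')
  refine ⟨d * b, ?_⟩
  suffices hz : (posRoot (d * b))⁻¹ * y * negRoot 1 = negRoot 1 * ((posRoot (d * b))⁻¹ * y) by
    rw [mul_inv_eq_iff_eq_mul, mul_assoc, mul_assoc, ← hz]
    group
  have hm : toMatrix ((posRoot (d * b))⁻¹ * y) = adMatrix d 0 c d := by
    rw [inv_posRoot, toMatrix_mul, toMatrix_posRoot, hy, adMatrix_mul]
    congr 1
    · linear_combination d * h - a * hd
    · linear_combination -b * hd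
    · ring
    · ring
  apply toMatrix_injective
  rw [toMatrix_mul, toMatrix_mul _ (_ * y), hm, toMatrix_negRoot, adMatrix_mul, adMatrix_mul]
  congr 1 <;> ring

end ElemA1

open ElemA1 in
/-- Every class-preserving endomorphism of `E(A₁,R)` is inner, provided `2 ∈ R^×`. -/
theorem classPreserving_endomorphism_isInner_ElemA1
    {R : Type*} [CommRing R] (h2 : IsUnit (2 : R))
    (φ : ElemA1 R →* ElemA1 R)
    (hcp : ∀ g : ElemA1 R, ∃ y : ElemA1 R, φ g = y * g * y⁻¹) :
    ∃ y : ElemA1 R, ∀ g : ElemA1 R, φ g = y * g * y⁻¹ := by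
  have htr (g : ElemA1 R) : (toMatrix (φ g)).trace = (toMatrix g).trace := by
    obtain ⟨y, hy⟩ := hcp g
    rw [hy, trace_toMatrix_conj]
  obtain ⟨u, hu⟩ := hcp (posRoot 1)
  obtain ⟨v, hv⟩ := hcp (negRoot 1)
  have hconj : ∀ s : R, s = 1 ∨ s = -1 → φ (negRoot s) = v * negRoot s * v⁻¹ := by
    rintro s (rfl | rfl)
    · exact hv
    · rw [← inv_negRoot, map_inv, hv]
      group
  obtain ⟨t, ht⟩ := exists_conj_negRoot_eq h2 (u⁻¹ * v) (fun s hs => by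
    rw [← htr (posRoot 1 * negRoot s), map_mul, hu, hconj s hs, ← trace_toMatrix_conj u]
    congr 2
    group)
  refine ⟨u * posRoot t, fun g => ?_⟩
  have key := apply_eq_self_of_trace h2
    ((MulAut.conj (u * posRoot t)⁻¹).toMonoidHom.comp φ) (fun g => ?_) ?_ ?_ g
  · simp only [MonoidHom.comp_apply, MulEquiv.coe_toMonoidHom, MulAut.conj_apply] at key
    conv_rhs => rw [← key]
    group
  · simp only [MonoidHom.comp_apply, MulEquiv.coe_toMonoidHom, MulAut.conj_apply]
    rw [trace_toMatrix_conj, htr]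
  · have hcomm : posRoot t * posRoot 1 = posRoot 1 * posRoot t := by
      rw [posRoot_mul, posRoot_mul, add_comm]
    simp only [MonoidHom.comp_apply, MulEquiv.coe_toMonoidHom, MulAut.conj_apply]
    rw [hu, inv_inv, _root_.mul_inv_rev]
    calc _ = (posRoot t)⁻¹ * (posRoot 1 * posRoot t) := by group
      _ = posRoot 1 := by rw [← hcomm, inv_mul_cancel_left]
  · simp only [MonoidHom.comp_apply, MulEquiv.coe_toMonoidHom, MulAut.conj_apply]
    rw [hv, inv_inv, _root_.mul_inv_rev]
    calc _ = (posRoot t)⁻¹ * (u⁻¹ * v * negRoot 1 * (u⁻¹ * v)⁻¹) * posRoot t := by group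
      _ = negRoot 1 := by rw [ht]; group
end

section
/- Let R be a commutative ring in which 2 is invertible, and let PGL₃(R) be the quotient of GL₃(R) by its center (the standard realization of the adjoint Chevalley group of type A₂ over R). Then every class-preserving endomorphism of PGL₃(R) is inner: if φ : PGL₃(R) → PGL₃(R) is a group homomorphism such that φ(g) is conjugate to g in PGL₃(R) for every g, then there exists y ∈ PGL₃(R) with φ(g) = y·g·y⁻¹ for all g. -/
open Matrix

/-- `PGL₃(R)`: the quotient of `GL₃(R)` by its center, the standard realization of the
adjoint Chevalley group of type A₂ over `R`. -/
abbrev PGL3 (R : Type*) [CommRing R] :=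
  GL (Fin 3) R ⧸ Subgroup.center (GL (Fin 3) R)

namespace PGL3

variable {R : Type*} [CommRing R]

/-- The projection `GL₃(R) → PGL₃(R)`. -/
abbrev proj : GL (Fin 3) R →* PGL3 R := QuotientGroup.mk' (Subgroup.center (GL (Fin 3) R))

/-- An endomorphism sending every element to one of its conjugates. -/
def IsClassPreserving {G : Type*} [Group G] (φ : G →* G) : Prop :=
  ∀ g, ∃ y, φ g = y * g * y⁻¹

/-- An endomorphism given by conjugation by a fixed element. -/
def IsInner {G : Type*} [Group G] (φ : G →* G) : Prop :=
  ∃ y, ∀ g, φ g = y * g * y⁻¹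

theorem IsClassPreserving.conj_comp {G : Type*} [Group G] {φ : G →* G}
    (h : IsClassPreserving φ) (y : G) :
    IsClassPreserving ((MulAut.conj y).toMonoidHom.comp φ) := by
  intro g
  obtain ⟨x, hx⟩ := h g
  exact ⟨y * x, by simp [hx, mul_assoc]⟩

theorem IsInner.of_conj_comp {G : Type*} [Group G] {φ : G →* G} (y : G)
    (h : IsInner ((MulAut.conj y).toMonoidHom.comp φ)) : IsInner φ := by
  obtain ⟨x, hx⟩ := h
  refine ⟨y⁻¹ * x, fun g => ?_⟩
  have := hx g
  simp only [MonoidHom.comp_apply, MulEquiv.coe_toMonoidHom, MulAut.conj_apply] at this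
  rw [_root_.mul_inv_rev, inv_inv, mul_assoc, mul_assoc, ← mul_assoc x, ← mul_assoc (x * g), ← this]
  group

/-! ### Scalars -/

theorem scalar_commute (μ : Rˣ) (g : GL (Fin 3) R) :
    Commute (GeneralLinearGroup.scalar (Fin 3) μ) g := by
  ext i j
  simp [GeneralLinearGroup.scalar, mul_comm]

theorem coe_scalar_mul (μ : Rˣ) (g : GL (Fin 3) R) :
    (GeneralLinearGroup.scalar (Fin 3) μ * g).val = (μ : R) • g.val := by
  ext i j
  simp [GeneralLinearGroup.scalar]

theorem proj_eq_proj_iff {a b : GL (Fin 3) R} :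
    proj a = proj b ↔ ∃ μ : Rˣ, a = GeneralLinearGroup.scalar (Fin 3) μ * b := by
  rw [eq_comm, QuotientGroup.mk'_eq_mk', GeneralLinearGroup.center_eq_range_scalar]
  constructor
  · rintro ⟨_, ⟨μ, rfl⟩, h⟩
    exact ⟨μ, by rw [← h, (scalar_commute _ _).eq]⟩
  · rintro ⟨μ, h⟩
    exact ⟨_, ⟨μ, rfl⟩, by rw [h, (scalar_commute _ _).eq]⟩

theorem proj_scalar_mul (μ : Rˣ) (g : GL (Fin 3) R) :
    proj (GeneralLinearGroup.scalar (Fin 3) μ * g) = proj g :=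
  proj_eq_proj_iff.mpr ⟨μ, rfl⟩

theorem det_scalar_mul (μ : Rˣ) (g : GL (Fin 3) R) :
    (GeneralLinearGroup.scalar (Fin 3) μ * g).det = μ ^ 3 * g.det := by
  ext
  simp [GeneralLinearGroup.scalar]

theorem exists_scalar_of_proj_eq {a b : GL (Fin 3) R} (h : proj a = proj b)
    (hdet : a.det = b.det) :
    ∃ μ : Rˣ, μ ^ 3 = 1 ∧ a = GeneralLinearGroup.scalar (Fin 3) μ * b := by
  obtain ⟨μ, rfl⟩ := proj_eq_proj_iff.mp h
  exact ⟨μ, by simpa [det_scalar_mul] using hdet, rfl⟩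

theorem eq_one_of_sq_of_cube {G : Type*} [Monoid G] {z : G} (h2 : z ^ 2 = 1) (h3 : z ^ 3 = 1) :
    z = 1 := by
  rwa [pow_succ, h2, one_mul] at h3

theorem eq_of_proj_eq_of_sq {a b : GL (Fin 3) R} (h : proj a = proj b) (hdet : a.det = b.det)
    (ha : a ^ 2 = 1) (hb : b ^ 2 = 1) : a = b := by
  obtain ⟨μ, h3, rfl⟩ := exists_scalar_of_proj_eq h hdet
  have hz : GeneralLinearGroup.scalar (Fin 3) μ = 1 := by
    refine eq_one_of_sq_of_cube ?_ (by rw [← map_pow, h3, map_one])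
    rwa [(scalar_commute μ b).mul_pow, hb, mul_one] at ha
  rw [hz, one_mul]

theorem IsClassPreserving.exists_lift {φ : PGL3 R →* PGL3 R} (h : IsClassPreserving φ)
    (g : GL (Fin 3) R) : ∃ p : GL (Fin 3) R, φ (proj g) = proj (p * g * p⁻¹) := by
  obtain ⟨y, hy⟩ := h (proj g)
  obtain ⟨p, rfl⟩ := QuotientGroup.mk'_surjective _ y
  exact ⟨p, by rw [hy, map_mul, map_mul, map_inv]⟩

theorem det_conj (p g : GL (Fin 3) R) : (p * g * p⁻¹).det = g.det := by
  rw [map_mul, map_mul, map_inv, mul_inv_cancel_comm]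

theorem trace_conj (p g : GL (Fin 3) R) : (p * g * p⁻¹).val.trace = g.val.trace := by
  rw [Units.val_mul, Units.val_mul, Matrix.trace_units_conj]

theorem IsClassPreserving.exists_trace_eq {φ : PGL3 R →* PGL3 R} (hφ : IsClassPreserving φ)
    {g h : GL (Fin 3) R} (hgh : φ (proj g) = proj h) (hdet : h.det = g.det) :
    ∃ μ : Rˣ, μ ^ 3 = 1 ∧ h.val.trace = μ * g.val.trace ∧
      h⁻¹.val.trace = (μ⁻¹ : Rˣ) * g⁻¹.val.trace := by
  obtain ⟨p, hp⟩ := hφ.exists_lift g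
  obtain ⟨μ, h3, hμ⟩ := exists_scalar_of_proj_eq (hgh.symm.trans hp) (by rw [hdet, det_conj])
  refine ⟨μ, h3, ?_, ?_⟩
  · rw [hμ, coe_scalar_mul, trace_smul, trace_conj, smul_eq_mul]
  · rw [hμ, _root_.mul_inv_rev, ← map_inv, ← (scalar_commute _ _).eq, coe_scalar_mul, trace_smul,
      conj_inv, trace_conj, smul_eq_mul]

/-! ### Some elements of `GL₃(R)` -/

/-- Diagonal matrices. -/
def diag (d : Fin 3 → Rˣ) : GL (Fin 3) R where
  val := diagonal fun i => (d i : R)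
  inv := diagonal fun i => ((d i)⁻¹ : Rˣ)
  val_inv := by simp
  inv_val := by simp

/-- The diagonal involution with eigenvalue `1` on the `i`-th coordinate and `-1` elsewhere. -/
def sgn (i : Fin 3) : GL (Fin 3) R := diag fun k => if k = i then 1 else -1

/-- The matrix of the cyclic permutation `e₀ ↦ e₁ ↦ e₂ ↦ e₀`. -/
def cyc : GL (Fin 3) R where
  val := !![0, 0, 1; 1, 0, 0; 0, 1, 0]
  inv := !![0, 1, 0; 0, 0, 1; 1, 0, 0]
  val_inv := by simp [one_fin_three]
  inv_val := by simp [one_fin_three]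

/-- The elementary matrix `1 + t E₀₁`. -/
def elem01 (t : R) : GL (Fin 3) R where
  val := !![1, t, 0; 0, 1, 0; 0, 0, 1]
  inv := !![1, -t, 0; 0, 1, 0; 0, 0, 1]
  val_inv := by simp [one_fin_three]
  inv_val := by simp [one_fin_three]

/-- The elementary matrix `1 + t E₀₂`. -/
def elem02 (t : R) : GL (Fin 3) R where
  val := !![1, 0, t; 0, 1, 0; 0, 0, 1]
  inv := !![1, 0, -t; 0, 1, 0; 0, 0, 1]
  val_inv := by simp [one_fin_three]
  inv_val := by simp [one_fin_three]

theorem sgn_sq (i : Fin 3) : (sgn i : GL (Fin 3) R) ^ 2 = 1 := by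
  ext k l
  fin_cases i <;> fin_cases k <;> fin_cases l <;> simp [sgn, diag, sq]

theorem diag_mul_comm (d e : Fin 3 → Rˣ) : diag d * diag e = diag e * diag d := by
  ext k l
  obtain rfl | h := eq_or_ne k l <;> simp_all [diag, mul_comm]

theorem det_sgn (i : Fin 3) : (sgn i : GL (Fin 3) R).det = 1 := by
  ext
  fin_cases i <;> simp [sgn, diag, Fin.prod_univ_three]

theorem det_cyc : (cyc : GL (Fin 3) R).det = 1 := by
  ext
  simp [cyc, det_fin_three]

theorem det_elem01 (t : R) : (elem01 t).det = 1 := by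
  ext
  simp [elem01, det_fin_three]

theorem sgn_conj_elem01_two (t : R) : sgn 2 * elem01 t * (sgn 2)⁻¹ = elem01 t := by
  rw [mul_inv_eq_iff_eq_mul]
  ext k l
  fin_cases k <;> fin_cases l <;> simp [sgn, diag, elem01]

theorem sgn_conj_elem01_zero (t : R) : sgn 0 * elem01 t * (sgn 0)⁻¹ = (elem01 t)⁻¹ := by
  rw [mul_inv_eq_iff_eq_mul]
  ext k l
  fin_cases k <;> fin_cases l <;> simp [sgn, diag, elem01]

theorem cyc_conj_sgn (i : Fin 3) :
    (cyc * sgn i * cyc⁻¹ : GL (Fin 3) R) = sgn (i + 1) := by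
  rw [mul_inv_eq_iff_eq_mul]
  ext k l
  fin_cases i <;> fin_cases k <;> fin_cases l <;> simp [sgn, diag, cyc]

/-! ### Diagonal involutions -/

theorem coe_sgn (i : Fin 3) : (sgn i : GL (Fin 3) R).val = (2 : R) • single i i 1 - 1 := by
  ext k l
  fin_cases i <;> fin_cases k <;> fin_cases l <;> simp [sgn, diag, single] <;> norm_num

theorem trace_sgn_mul_sgn {i j : Fin 3} (hij : i ≠ j) :
    (sgn i * sgn j : GL (Fin 3) R).val.trace = -1 := by
  fin_cases i <;> fin_cases j <;>
    first | exact absurd rfl hij | simp [sgn, diag, Fin.sum_univ_three]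

theorem commute_of_scalar_mul {G : Type*} [Group G] {a b z c : G} (ha : a ^ 2 = 1)
    (hb : b ^ 2 = 1) (hc : c ^ 2 = 1) (hz : ∀ g, Commute z g) (h3 : z ^ 3 = 1)
    (hab : a * b = z * c) : a * b = c ∧ Commute a b := by
  have ha' : a⁻¹ = a := inv_eq_of_mul_eq_one_right (by rw [← sq, ha])
  have hb' : b⁻¹ = b := inv_eq_of_mul_eq_one_right (by rw [← sq, hb])
  have hsq : (a * b) ^ 2 = z ^ 2 := by rw [hab, (hz c).mul_pow, hc, mul_one]
  have hinv : (b * a) ^ 2 = z ^ 2 := by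
    calc (b * a) ^ 2 = a⁻¹ * (a * b) ^ 2 * a := by simp only [sq]; group
      _ = z ^ 2 := by rw [hsq, mul_assoc, ((hz a).pow_left 2).eq, inv_mul_cancel_left]
  have h4 : z ^ 2 * z ^ 2 = 1 := by
    nth_rewrite 1 [← hsq]
    rw [← hinv]
    calc (a * b) ^ 2 * (b * a) ^ 2 = a * b * a * b ^ 2 * a * b * a := by simp only [sq]; group
      _ = a * b * a ^ 2 * b * a := by rw [hb, mul_one]; simp only [sq]; group
      _ = a * b ^ 2 * a := by rw [ha, mul_one]; simp only [sq]; group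
      _ = 1 := by rw [hb, mul_one, ← sq, ha]
  have hz1 : z = 1 := by
    rw [← pow_add, pow_succ, h3, one_mul] at h4
    exact h4
  refine ⟨by rw [hab, hz1, one_mul], ?_⟩
  rw [hz1, one_pow, sq] at hsq
  rw [Commute, SemiconjBy, ← inv_eq_of_mul_eq_one_right hsq, _root_.mul_inv_rev, ha', hb']

theorem single_mul_mul_single_self (i : Fin 3) (M : Matrix (Fin 3) (Fin 3) R) :
    single i i 1 * M * single i i 1 = (single i i 1 * M).trace • single i i 1 := by
  rw [single_mul_mul_single, trace_single_mul]
  simp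

/-- The idempotent matrix `p Eᵢᵢ p⁻¹`. -/
def idem (p : GL (Fin 3) R) (i : Fin 3) : Matrix (Fin 3) (Fin 3) R :=
  p.val * single i i 1 * p⁻¹.val

theorem idem_mul_self (p : GL (Fin 3) R) (i : Fin 3) : idem p i * idem p i = idem p i := by
  simp only [idem, Matrix.mul_assoc]
  rw [← Matrix.mul_assoc p⁻¹.val, Units.inv_mul, Matrix.one_mul, ← Matrix.mul_assoc (single i i 1),
    single_mul_single_same, mul_one]

theorem idem_mul_mul_idem (p : GL (Fin 3) R) (i : Fin 3) (M : Matrix (Fin 3) (Fin 3) R) :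
    idem p i * M * idem p i = (idem p i * M).trace • idem p i := by
  have h := single_mul_mul_single_self i (p⁻¹.val * M * p.val)
  calc idem p i * M * idem p i
      = p.val * (single i i 1 * (p⁻¹.val * M * p.val) * single i i 1) * p⁻¹.val := by
        simp only [idem, Matrix.mul_assoc]
    _ = (idem p i * M).trace • idem p i := by
        rw [h, Matrix.mul_smul, Matrix.smul_mul, idem, ← Matrix.mul_assoc, trace_mul_comm]
        simp only [Matrix.mul_assoc]

theorem coe_conj_sgn (p : GL (Fin 3) R) (i : Fin 3) :
    (p * sgn i * p⁻¹).val = (2 : R) • idem p i - 1 := by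
  rw [Units.val_mul, Units.val_mul, coe_sgn, idem, Matrix.mul_sub, Matrix.sub_mul, Matrix.mul_one,
    Units.mul_inv, Matrix.mul_smul, Matrix.smul_mul]

theorem idem_mul_idem_eq_zero (h2 : IsUnit (2 : R)) {p q : GL (Fin 3) R} {i j : Fin 3}
    (hcomm : Commute (p * sgn i * p⁻¹) (q * sgn j * q⁻¹))
    (htr : (p * sgn i * p⁻¹ * (q * sgn j * q⁻¹)).val.trace = -1) :
    idem p i * idem q j = 0 := by
  have h4 : IsUnit (4 : R) := by convert h2.mul h2 using 1; norm_num
  have hmul : (p * sgn i * p⁻¹ * (q * sgn j * q⁻¹)).val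
      = (4 : R) • (idem p i * idem q j) - (2 : R) • idem p i - (2 : R) • idem q j + 1 := by
    rw [Units.val_mul, coe_conj_sgn, coe_conj_sgn]
    simp only [sub_mul, mul_sub, smul_mul_smul_comm, mul_one, one_mul]
    module
  have hmul' : (q * sgn j * q⁻¹ * (p * sgn i * p⁻¹)).val
      = (4 : R) • (idem q j * idem p i) - (2 : R) • idem p i - (2 : R) • idem q j + 1 := by
    rw [Units.val_mul, coe_conj_sgn, coe_conj_sgn]
    simp only [sub_mul, mul_sub, smul_mul_smul_comm, mul_one, one_mul]
    module
  have hc : idem p i * idem q j = idem q j * idem p i := by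
    have := hmul.symm.trans ((congrArg Units.val hcomm.eq).trans hmul')
    simpa [h4.smul_left_cancel] using this
  have ht (p : GL (Fin 3) R) (i : Fin 3) : (idem p i).trace = 1 := by
    rw [idem, trace_units_conj]
    simp
  have htr0 : (idem p i * idem q j).trace = 0 := by
    rw [hmul] at htr
    simp [ht] at htr
    have h : (4 : R) * (idem p i * idem q j).trace = 0 := by linear_combination htr
    exact (h4.mul_right_eq_zero).mp h
  rw [← idem_mul_self, mul_assoc, hc, ← mul_assoc, idem_mul_mul_idem, htr0, zero_smul]

theorem exists_simultaneous_conj (p : Fin 3 → GL (Fin 3) R)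
    (h0 : ∀ i j, i ≠ j → idem (p i) i * idem (p j) j = 0) :
    ∃ P : GL (Fin 3) R, ∀ i, p i * sgn i * (p i)⁻¹ = P * sgn i * P⁻¹ := by
  set P : Matrix (Fin 3) (Fin 3) R := ∑ i, (p i).val * single i i 1 with hP
  set Q : Matrix (Fin 3) (Fin 3) R := ∑ i, single i i 1 * (p i)⁻¹.val with hQ
  have horth (i j : Fin 3) (hij : i ≠ j) :
      single i i 1 * (p i)⁻¹.val * ((p j).val * single j j 1) = 0 := by
    have := congrArg (fun M => (p i)⁻¹.val * M * (p j).val) (h0 i j hij)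
    simp only [idem, Matrix.mul_zero, Matrix.zero_mul] at this
    rw [← this]
    simp only [Matrix.mul_assoc, Units.inv_mul, Units.inv_mul_cancel_left, Matrix.mul_one]
  have hself (i : Fin 3) :
      single i i 1 * (p i)⁻¹.val * ((p i).val * single i i 1) = single i i 1 := by
    rw [Matrix.mul_assoc, ← Matrix.mul_assoc (p i)⁻¹.val, Units.inv_mul, Matrix.one_mul,
      single_mul_single_same, mul_one]
  have hQP : Q * P = 1 := by
    rw [hP, hQ, Finset.sum_mul_sum]
    have : ∀ i, ∑ j, single i i 1 * (p i)⁻¹.val * ((p j).val * single j j 1) = single i i 1 := by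
      intro i
      rw [Finset.sum_eq_single i (fun j _ hj => horth i j hj.symm) (by simp), hself]
    simp only [this]
    rw [Matrix.sum_single_one]
  have hPQ : P * Q = 1 := mul_eq_one_comm.mp hQP
  have hPi (i : Fin 3) : idem (p i) i * P = P * single i i 1 := by
    have hl : idem (p i) i * P = (p i).val * single i i 1 := by
      rw [hP, Finset.mul_sum, Finset.sum_eq_single i]
      · rw [idem, Matrix.mul_assoc, Matrix.mul_assoc, ← Matrix.mul_assoc (single i i 1), hself]
      · intro j _ hj
        rw [idem, Matrix.mul_assoc, Matrix.mul_assoc, ← Matrix.mul_assoc (single i i 1),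
          horth i j hj.symm, Matrix.mul_zero]
      · simp
    rw [hl, hP, Finset.sum_mul, Finset.sum_eq_single i]
    · rw [Matrix.mul_assoc, single_mul_single_same, mul_one]
    · intro j _ hj
      rw [Matrix.mul_assoc, single_mul_single_of_ne (h := hj), Matrix.mul_zero]
    · simp
  refine ⟨⟨P, Q, hPQ, hQP⟩, fun i => ?_⟩
  rw [eq_mul_inv_iff_mul_eq]
  ext1
  rw [Units.val_mul, coe_conj_sgn, Units.val_mul, coe_sgn, Matrix.sub_mul, Matrix.smul_mul,
    Matrix.mul_sub, Matrix.mul_smul, hPi, Matrix.one_mul, Matrix.mul_one]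

theorem IsClassPreserving.exists_conj_sgn (h2 : IsUnit (2 : R)) {φ : PGL3 R →* PGL3 R}
    (hφ : IsClassPreserving φ) :
    ∃ P : GL (Fin 3) R, ∀ i, φ (proj (sgn i)) = proj (P * sgn i * P⁻¹) := by
  choose p hp using fun i => hφ.exists_lift (sgn i)
  have hsq (i : Fin 3) : (p i * sgn i * (p i)⁻¹) ^ 2 = 1 := by
    rw [conj_pow, sgn_sq, mul_one, mul_inv_cancel]
  obtain ⟨P, hP⟩ := exists_simultaneous_conj p fun i j hij => by
    obtain ⟨q, hq⟩ := hφ.exists_lift (sgn i * sgn j)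
    rw [map_mul, map_mul, hp, hp, ← map_mul] at hq
    obtain ⟨μ, h3, hμ⟩ := exists_scalar_of_proj_eq hq (by
      rw [map_mul, det_conj, det_conj, det_conj, map_mul])
    have hs : (sgn i * sgn j : GL (Fin 3) R) ^ 2 = 1 := by
      rw [(show Commute (sgn i : GL (Fin 3) R) (sgn j) from diag_mul_comm _ _).mul_pow, sgn_sq,
        sgn_sq, mul_one]
    obtain ⟨h, hc⟩ := commute_of_scalar_mul (hsq i) (hsq j)
      (by rw [conj_pow, hs, mul_one, mul_inv_cancel]) (scalar_commute μ)
      (by rw [← map_pow, h3, map_one]) hμ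
    exact idem_mul_idem_eq_zero h2 hc (by rw [h, trace_conj, trace_sgn_mul_sgn hij])
  exact ⟨P, fun i => by rw [hp, hP]⟩

/-! ### The cyclic permutation -/

theorem eq_zero_of_eq_neg (h2 : IsUnit (2 : R)) {x : R} (hx : x = -x) : x = 0 :=
  h2.mul_right_eq_zero.mp (by linear_combination hx)

theorem coe_sgn_eq_diagonal (i : Fin 3) :
    (sgn i : GL (Fin 3) R).val = diagonal fun k => if k = i then 1 else -1 := by
  simp only [sgn, diag]
  congr 1
  ext k
  split_ifs <;> simp

theorem sgn_mul_apply (i : Fin 3) (g : GL (Fin 3) R) (k l : Fin 3) :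
    (sgn i * g).val k l = (if k = i then 1 else -1) * g.val k l := by
  rw [Units.val_mul, coe_sgn_eq_diagonal, diagonal_mul]

theorem mul_sgn_apply (g : GL (Fin 3) R) (i k l : Fin 3) :
    (g * sgn i).val k l = g.val k l * (if l = i then 1 else -1) := by
  rw [Units.val_mul, coe_sgn_eq_diagonal, mul_diagonal]

theorem exists_diag_conj_cyc (h2 : IsUnit (2 : R)) {W : GL (Fin 3) R} (hdet : W.det = 1)
    (hW : ∀ i, W * sgn i * W⁻¹ = sgn (i + 1)) :
    ∃ d : Fin 3 → Rˣ, W = diag d * cyc * (diag d)⁻¹ := by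
  have h0 (k l : Fin 3) (hkl : k ≠ l + 1) : W.val k l = 0 := by
    have h : (W * sgn l).val k l = (sgn (l + 1) * W).val k l := by
      rw [mul_inv_eq_iff_eq_mul.mp (hW l)]
    rw [sgn_mul_apply, mul_sgn_apply, if_pos rfl, if_neg hkl, mul_one, neg_one_mul] at h
    exact eq_zero_of_eq_neg h2 h
  have hprod : W.val 1 0 * W.val 2 1 * W.val 0 2 = 1 := by
    have := congrArg Units.val hdet
    rw [GeneralLinearGroup.val_det_apply, det_fin_three, h0 0 0 (by decide), h0 1 1 (by decide),
      h0 2 2 (by decide), h0 0 1 (by decide), h0 2 0 (by decide), Units.val_one] at this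
    linear_combination this
  obtain ⟨a, ha⟩ : IsUnit (W.val 1 0) :=
    .of_mul_eq_one (W.val 2 1 * W.val 0 2) (by linear_combination hprod)
  obtain ⟨b, hb⟩ : IsUnit (W.val 2 1) :=
    .of_mul_eq_one (W.val 1 0 * W.val 0 2) (by linear_combination hprod)
  refine ⟨![1, a, a * b], ?_⟩
  rw [eq_mul_inv_iff_mul_eq]
  ext k l
  rw [Units.val_mul, Units.val_mul]
  simp only [diag, mul_diagonal, diagonal_mul, cyc]
  fin_cases k <;> fin_cases l <;> simp [h0, ha, hb, mul_comm]
  linear_combination hprod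

theorem IsClassPreserving.exists_conj_cyc (h2 : IsUnit (2 : R)) {φ : PGL3 R →* PGL3 R}
    (hφ : IsClassPreserving φ) (hs : ∀ i, φ (proj (sgn i)) = proj (sgn i)) :
    ∃ d : Fin 3 → Rˣ, φ (proj cyc) = proj (diag d * cyc * (diag d)⁻¹) := by
  obtain ⟨q, hq⟩ := hφ.exists_lift cyc
  have hW (i : Fin 3) :
      q * cyc * q⁻¹ * sgn i * (q * cyc * q⁻¹)⁻¹ = sgn (i + 1) := by
    refine eq_of_proj_eq_of_sq ?_ (by rw [det_conj, det_sgn, det_sgn])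
      (by rw [conj_pow, sgn_sq, mul_one, mul_inv_cancel]) (sgn_sq _)
    rw [← hs, ← cyc_conj_sgn]
    simp only [map_mul φ, map_mul proj, map_inv, hs] at hq ⊢
    rw [hq]
  obtain ⟨d, hd⟩ := exists_diag_conj_cyc h2 (by rw [det_conj, det_cyc]) hW
  exact ⟨d, by rw [hq, hd]⟩

/-! ### Elementary matrices -/

theorem coe_conj_elem01 (p : GL (Fin 3) R) (t : R) (k l : Fin 3) :
    (p * elem01 t * p⁻¹).val k l = (1 : Matrix (Fin 3) (Fin 3) R) k l +
      t * (p.val k 0 * p⁻¹.val 1 l) := by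
  have h : (elem01 t).val = 1 + t • vecMulVec ![1, 0, 0] ![0, 1, 0] := by
    ext k l
    fin_cases k <;> fin_cases l <;> simp [elem01, vecMulVec]
  rw [Units.val_mul, Units.val_mul, h, Matrix.mul_add, Matrix.add_mul, Matrix.mul_one,
    Units.mul_inv, Matrix.mul_smul, Matrix.smul_mul, mul_vecMulVec, vecMulVec_mul]
  simp [vecMulVec, mulVec, vecMul, dotProduct, Fin.sum_univ_three]

theorem scalar_eq_one_of_conj_elem01 {p : GL (Fin 3) R} {s t : R} {μ : Rˣ}
    (h : p * elem01 t * p⁻¹ = GeneralLinearGroup.scalar (Fin 3) μ * elem01 s)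
    (hs : s = t ∨ s = -t) : μ = 1 := by
  have h' (k l : Fin 3) : (1 : Matrix (Fin 3) (Fin 3) R) k l +
      t * (p.val k 0 * p⁻¹.val 1 l) = μ * (elem01 s).val k l := by
    rw [← coe_conj_elem01, h, coe_scalar_mul, Matrix.smul_apply, smul_eq_mul]
  have h01 : t * (p.val 0 0 * p⁻¹.val 1 1) = μ * s := by
    rw [← zero_add (t * _)]; exact h' 0 1
  have h02 : t * (p.val 0 0 * p⁻¹.val 1 2) = μ * 0 := by
    rw [← zero_add (t * _)]; exact h' 0 2
  have h22 : 1 + t * (p.val 2 0 * p⁻¹.val 1 2) = μ * 1 := h' 2 2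
  have hε : (μ : R) * (μ - 1) = 0 := by
    obtain rfl | rfl := hs
    · linear_combination (-μ : R) * h22 - (p.val 2 0 * p⁻¹.val 1 2) * h01 +
        (p.val 2 0 * p⁻¹.val 1 1) * h02
    · linear_combination (-μ : R) * h22 + (p.val 2 0 * p⁻¹.val 1 2) * h01 -
        (p.val 2 0 * p⁻¹.val 1 1) * h02
  ext
  rw [Units.val_one]
  exact sub_eq_zero.mp ((Units.mul_right_eq_zero μ).mp hε)

theorem conj_elem01_inv (p : GL (Fin 3) R) (t : R) :
    (p * elem01 t * p⁻¹)⁻¹ = p * elem01 (-t) * p⁻¹ := by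
  rw [conj_inv]
  congr 2
  ext k l
  fin_cases k <;> fin_cases l <;> simp [elem01]

theorem conj_elem01_eq_of_proj_eq {y q : GL (Fin 3) R} {s t : R}
    (h : proj (y * (q * elem01 t * q⁻¹) * y⁻¹) = proj (q * elem01 s * q⁻¹))
    (hs : s = t ∨ s = -t) :
    y * (q * elem01 t * q⁻¹) * y⁻¹ = q * elem01 s * q⁻¹ := by
  obtain ⟨μ, -, hμ⟩ := exists_scalar_of_proj_eq h (by simp only [det_conj, det_elem01])
  have h1 : μ = 1 := by
    refine scalar_eq_one_of_conj_elem01 (p := q⁻¹ * y * q) (t := t) (s := s) ?_ hs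
    calc q⁻¹ * y * q * elem01 t * (q⁻¹ * y * q)⁻¹
        = q⁻¹ * (y * (q * elem01 t * q⁻¹) * y⁻¹) * q := by group
      _ = GeneralLinearGroup.scalar (Fin 3) μ * elem01 s := by
        rw [hμ, ← mul_assoc, ← (scalar_commute μ q⁻¹).eq]
        group
  rw [hμ, h1, map_one, one_mul]

theorem trace_cyc_mul (g : GL (Fin 3) R) :
    (cyc * g).val.trace = g.val 2 0 + g.val 0 1 + g.val 1 2 := by
  rw [Units.val_mul, trace_fin_three]
  simp [cyc, Matrix.mul_apply, Fin.sum_univ_three]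

theorem coe_cyc_inv : (cyc⁻¹ : GL (Fin 3) R).val = !![0, 1, 0; 0, 0, 1; 1, 0, 0] := rfl

theorem trace_cyc_mul_inv (g : GL (Fin 3) R) :
    (cyc * g)⁻¹.val.trace = g⁻¹.val 0 2 + g⁻¹.val 1 0 + g⁻¹.val 2 1 := by
  rw [_root_.mul_inv_rev, Units.val_mul, coe_cyc_inv, trace_fin_three]
  simp [-coe_units_inv, Matrix.mul_apply, Fin.sum_univ_three]

theorem coe_elem01_inv (t : R) : (elem01 t)⁻¹.val = !![1, -t, 0; 0, 1, 0; 0, 0, 1] := rfl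

theorem coe_elem02_inv (t : R) : (elem02 t)⁻¹.val = !![1, 0, -t; 0, 1, 0; 0, 0, 1] := rfl

theorem conj_comp_proj {φ : PGL3 R →* PGL3 R} {a b : GL (Fin 3) R} (h : φ (proj a) = proj b)
    (y : GL (Fin 3) R) :
    (MulAut.conj (proj y)).toMonoidHom.comp φ (proj a) = proj (y * b * y⁻¹) := by
  rw [MonoidHom.comp_apply, h, MulEquiv.coe_toMonoidHom, MulAut.conj_apply, map_mul, map_mul,
    map_inv]

theorem map_conj_of_fixed {φ : PGL3 R →* PGL3 R} {s a b : GL (Fin 3) R}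
    (hs : φ (proj s) = proj s) (ha : φ (proj a) = proj b) :
    φ (proj (s * a * s⁻¹)) = proj (s * b * s⁻¹) := by
  simp only [map_mul φ, map_mul proj, map_inv, hs, ha]

theorem IsClassPreserving.exists_elem01 (h2 : IsUnit (2 : R)) {φ : PGL3 R →* PGL3 R}
    (hφ : IsClassPreserving φ) (hs : ∀ i, φ (proj (sgn i)) = proj (sgn i))
    (hc : φ (proj cyc) = proj cyc) (t : R) :
    ∃ μ : Rˣ, μ ^ 3 = 1 ∧ φ (proj (elem01 t)) = proj (elem01 (μ * t)) := by
  obtain ⟨q, hq⟩ := hφ.exists_lift (elem01 t)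
  obtain ⟨X, hX⟩ : ∃ X, X = q * elem01 t * q⁻¹ := ⟨_, rfl⟩
  rw [← hX] at hq
  have hcomm : sgn 2 * X * (sgn 2)⁻¹ = X := by
    have h : proj (sgn 2 * X * (sgn 2)⁻¹) = proj X := by
      rw [← map_conj_of_fixed (hs 2) hq, sgn_conj_elem01_two, hq]
    rw [hX] at h ⊢
    exact conj_elem01_eq_of_proj_eq h (.inl rfl)
  have hanti : sgn 0 * X * (sgn 0)⁻¹ = X⁻¹ := by
    have h : proj (sgn 0 * X * (sgn 0)⁻¹) = proj X⁻¹ := by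
      rw [← map_conj_of_fixed (hs 0) hq, sgn_conj_elem01_zero, map_inv, map_inv, map_inv, hq]
    rw [hX, conj_elem01_inv] at h ⊢
    exact conj_elem01_eq_of_proj_eq h (.inr rfl)
  have hcomm' (k l : Fin 3) :
      (if k = 2 then 1 else -1) * X.val k l = X.val k l * (if l = 2 then 1 else -1) := by
    rw [← sgn_mul_apply, ← mul_sgn_apply, mul_inv_eq_iff_eq_mul.mp hcomm]
  have hinv (k l : Fin 3) :
      X⁻¹.val k l = 2 * (1 : Matrix (Fin 3) (Fin 3) R) k l - X.val k l := by
    rw [hX, conj_elem01_inv, coe_conj_elem01, coe_conj_elem01]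
    ring
  have hanti' (k l : Fin 3) :
      (if k = 0 then 1 else -1) * X.val k l =
        (2 * (1 : Matrix (Fin 3) (Fin 3) R) k l - X.val k l) * (if l = 0 then 1 else -1) := by
    rw [← sgn_mul_apply, ← hinv, ← mul_sgn_apply, mul_inv_eq_iff_eq_mul.mp hanti]
  have h02 : X.val 0 2 = 0 := eq_zero_of_eq_neg h2 (by simpa using (hcomm' 0 2).symm)
  have h12 : X.val 1 2 = 0 := eq_zero_of_eq_neg h2 (by simpa using (hcomm' 1 2).symm)
  have h20 : X.val 2 0 = 0 := eq_zero_of_eq_neg h2 (by simpa using hcomm' 2 0)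
  have h21 : X.val 2 1 = 0 := eq_zero_of_eq_neg h2 (by simpa using hcomm' 2 1)
  have hdiag (k : Fin 3) : X.val k k = 1 := by
    have h := hanti' k k
    rw [one_apply_eq] at h
    refine h2.mul_left_cancel ?_
    split_ifs at h
    · linear_combination h
    · linear_combination -h
  obtain ⟨μ, h3, htr, htr'⟩ := hφ.exists_trace_eq (g := cyc * elem01 t) (h := cyc * X)
    (by simp only [map_mul φ, map_mul proj, hc, hq])
    (by rw [map_mul, hX, det_conj, map_mul])
  rw [trace_cyc_mul, trace_cyc_mul, h20, h12] at htr
  rw [trace_cyc_mul_inv, trace_cyc_mul_inv, coe_elem01_inv, hinv, hinv, hinv, h02, h21] at htr'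
  have h01 : X.val 0 1 = μ * t := by simpa [elem01] using htr
  have h10 : X.val 1 0 = 0 := by simpa using htr'
  refine ⟨μ, h3, ?_⟩
  rw [hq]
  congr 1
  ext k l
  fin_cases k <;> fin_cases l <;> simp [elem01, hdiag, h01, h02, h10, h12, h20, h21]

theorem elem01_commutator (s t : R) :
    elem01 s * (cyc * elem01 t * cyc⁻¹) * (elem01 s)⁻¹ * (cyc * elem01 t * cyc⁻¹)⁻¹
      = elem02 (s * t) := by
  rw [mul_inv_eq_iff_eq_mul, mul_inv_eq_iff_eq_mul]
  ext k l
  simp only [Units.val_mul, cyc, elem01, elem02]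
  fin_cases k <;> fin_cases l <;> simp

theorem IsClassPreserving.fix_elem01 {φ : PGL3 R →* PGL3 R}
    (hφ : IsClassPreserving φ) (hc : φ (proj cyc) = proj cyc)
    (h1 : φ (proj (elem01 1)) = proj (elem01 1)) {t : R} {μ : Rˣ}
    (ht : φ (proj (elem01 t)) = proj (elem01 (μ * t))) :
    φ (proj (elem01 t)) = proj (elem01 t) := by
  have h02 : φ (proj (elem02 1)) = proj (elem02 1) := by
    rw [← mul_one (1 : R), ← elem01_commutator]
    simp only [map_mul φ, map_mul proj, map_inv, hc, h1]
  obtain ⟨ν, -, htr, htr'⟩ := hφ.exists_trace_eq (g := cyc * (elem01 t * elem02 1))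
    (h := cyc * (elem01 (μ * t) * elem02 1))
    (by simp only [map_mul φ, map_mul proj, hc, h02, ht])
    (by simp only [map_mul, det_elem01])
  rw [trace_cyc_mul, trace_cyc_mul] at htr
  rw [trace_cyc_mul_inv, trace_cyc_mul_inv, _root_.mul_inv_rev, _root_.mul_inv_rev, Units.val_mul,
    Units.val_mul, coe_elem01_inv, coe_elem01_inv, coe_elem02_inv] at htr'
  have hν : ν = 1 := by
    have : (ν⁻¹ : Rˣ) = 1 := by
      ext
      simpa using htr'.symm
    simpa using this
  have hb : μ * t = t := by
    simpa [elem01, elem02, hν] using htr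
  rw [ht, hb]

/-! ### Generation by elementary matrices -/

theorem cyc_conj_apply (M : Matrix (Fin 3) (Fin 3) R) (k l : Fin 3) :
    ((cyc : GL (Fin 3) R).val * M * (cyc⁻¹ : GL (Fin 3) R).val) (k + 1) (l + 1) = M k l := by
  rw [coe_cyc_inv]
  fin_cases k <;> fin_cases l <;> 
    simp [cyc, Matrix.mul_apply, vecMul, dotProduct, Fin.sum_univ_three]

theorem coe_cyc_conj {x : GL (Fin 3) R} {i j : Fin 3} {t : R} (hx : x.val = transvection i j t) :
    (cyc * x * cyc⁻¹).val = transvection (i + 1) (j + 1) t := by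
  ext k l
  obtain ⟨k, rfl⟩ : ∃ k', k = k' + 1 := ⟨k - 1, by simp⟩
  obtain ⟨l, rfl⟩ : ∃ l', l = l' + 1 := ⟨l - 1, by simp⟩
  rw [Units.val_mul, Units.val_mul, cyc_conj_apply, hx]
  simp [transvection, single, Matrix.one_apply]

theorem coe_cyc_pow_conj {x : GL (Fin 3) R} {i j : Fin 3} {t : R}
    (hx : x.val = transvection i j t) (n : ℕ) :
    (cyc ^ n * x * (cyc ^ n)⁻¹).val = transvection (i + Fin.ofNat 3 n) (j + Fin.ofNat 3 n) t := by
  induction n with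
  | zero => simpa using hx
  | succ n ih =>
    have h : cyc ^ (n + 1) * x * (cyc ^ (n + 1))⁻¹ = cyc * (cyc ^ n * x * (cyc ^ n)⁻¹) * cyc⁻¹ := by
      rw [pow_succ']
      group
    have hn : Fin.ofNat 3 (n + 1) = Fin.ofNat 3 n + 1 := by
      ext
      simp [Fin.val_add]
    rw [h, coe_cyc_conj ih, hn, add_assoc, add_assoc]

theorem coe_elem01 (t : R) : (elem01 t).val = transvection 0 1 t := by
  ext k l
  fin_cases k <;> fin_cases l <;> simp [elem01, transvection, single]

theorem coe_elem02 (t : R) : (elem02 t).val = transvection 0 2 t := by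
  ext k l
  fin_cases k <;> fin_cases l <;> simp [elem02, transvection, single]

theorem exists_mem_eq_transvection {K : Subgroup (GL (Fin 3) R)}
    (hK : ∀ (n : ℕ) (t : R), cyc ^ n * elem01 t * (cyc ^ n)⁻¹ ∈ K) {i j : Fin 3} (hij : i ≠ j)
    (t : R) : ∃ x ∈ K, x.val = transvection i j t := by
  have hK' (n : ℕ) (t : R) : cyc ^ n * elem02 t * (cyc ^ n)⁻¹ ∈ K := by
    have h : cyc ^ n * elem02 t * (cyc ^ n)⁻¹ =
        cyc ^ n * elem01 t * (cyc ^ n)⁻¹ * (cyc ^ (n + 1) * elem01 1 * (cyc ^ (n + 1))⁻¹) *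
          (cyc ^ n * elem01 t * (cyc ^ n)⁻¹)⁻¹ *
          (cyc ^ (n + 1) * elem01 1 * (cyc ^ (n + 1))⁻¹)⁻¹ := by
      rw [← mul_one t, ← elem01_commutator, mul_one, pow_succ]
      group
    rw [h]
    exact K.mul_mem (K.mul_mem (K.mul_mem (hK _ _) (hK _ _)) (K.inv_mem (hK _ _)))
      (K.inv_mem (hK _ _))
  obtain rfl | rfl : j = 1 + i ∨ j = 2 + i := by
    revert i j
    decide
  · exact ⟨_, hK i.val t, by rw [coe_cyc_pow_conj (coe_elem01 t)]; simp⟩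
  · exact ⟨_, hK' i.val t, by rw [coe_cyc_pow_conj (coe_elem02 t)]; simp⟩

section Transvections

variable {S : Submonoid (Matrix (Fin 3) (Fin 3) R)}

theorem one_add_vecMulVec_single_mem (hS : ∀ i j, i ≠ j → ∀ t, transvection i j t ∈ S)
    {k : Fin 3} {v : Fin 3 → R} (hv : v k = 0) : 1 + vecMulVec v (Pi.single k 1) ∈ S := by
  have h : 1 + vecMulVec v (Pi.single k 1) =
      transvection (k + 1) k (v (k + 1)) * transvection (k + 2) k (v (k + 2)) := by
    ext a b
    fin_cases k <;> fin_cases a <;> fin_cases b <;>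
      simp_all [transvection, single, vecMulVec, Matrix.mul_apply, Fin.sum_univ_three]
  rw [h]
  exact S.mul_mem (hS _ _ (by simp) _) (hS _ _ (by simp) _)

theorem one_add_single_vecMulVec_mem (hS : ∀ i j, i ≠ j → ∀ t, transvection i j t ∈ S)
    {k : Fin 3} {w : Fin 3 → R} (hw : w k = 0) : 1 + vecMulVec (Pi.single k 1) w ∈ S := by
  have h : 1 + vecMulVec (Pi.single k 1) w =
      transvection k (k + 1) (w (k + 1)) * transvection k (k + 2) (w (k + 2)) := by
    ext a b
    fin_cases k <;> fin_cases a <;> fin_cases b <;>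
      simp_all [transvection, single, vecMulVec, Matrix.mul_apply, Fin.sum_univ_three]
  rw [h]
  exact S.mul_mem (hS _ _ (by simp) _) (hS _ _ (by simp) _)

theorem one_add_vecMulVec_mem_of_apply_eq_zero (hS : ∀ i j, i ≠ j → ∀ t, transvection i j t ∈ S)
    {k : Fin 3} {u w : Fin 3 → R} (hw : w k = 0) (hwu : w ⬝ᵥ u = 0) :
    1 + vecMulVec u w ∈ S := by
  set e : Fin 3 → R := Pi.single k 1 with he
  set v : Fin 3 → R := u - u k • e with hv
  have hvk : v k = 0 := by simp [hv, he]
  have hA (c : R) : 1 + c • vecMulVec v e ∈ S := by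
    rw [← smul_vecMulVec]
    exact one_add_vecMulVec_single_mem hS (by simp [hvk])
  have hB (c : R) : 1 + c • vecMulVec e w ∈ S := by
    rw [← vecMulVec_smul]
    exact one_add_single_vecMulVec_mem hS (by simp [hw])
  have hAB : vecMulVec v e * vecMulVec e w = vecMulVec v w := by
    rw [vecMulVec_mul_vecMulVec]
    simp [he]
  have hBB : vecMulVec e w * vecMulVec e w = 0 := by
    rw [vecMulVec_mul_vecMulVec]
    simp [he, hw]
  have hAA : vecMulVec v e * vecMulVec v e = 0 := by
    rw [vecMulVec_mul_vecMulVec]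
    simp [he, hvk]
  have hBA : vecMulVec e w * vecMulVec v e = 0 := by
    have : w ⬝ᵥ v = 0 := by simp [hv, he, hw, hwu]
    rw [vecMulVec_mul_vecMulVec, this]
    simp
  have huw : vecMulVec u w = vecMulVec v w + u k • vecMulVec e w := by
    rw [hv, sub_vecMulVec, smul_vecMulVec, sub_add_cancel]
  have h : 1 + vecMulVec u w = (1 + (1 : R) • vecMulVec v e) * (1 + (1 : R) • vecMulVec e w) *
      (1 + (-1 : R) • vecMulVec v e) * (1 + (-1 : R) • vecMulVec e w) *
      (1 + u k • vecMulVec e w) := by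
    rw [huw, ← hAB]
    generalize vecMulVec v e = A at *
    generalize vecMulVec e w = B at *
    have hABA : A * B * A = 0 := by rw [mul_assoc, hBA, mul_zero]
    have hABB : A * B * B = 0 := by rw [mul_assoc, hBB, mul_zero]
    simp only [mul_add, add_mul, mul_smul_comm, smul_mul_assoc, hAA, hBB, hBA, hABA, hABB, one_mul,
      mul_one, smul_zero, add_zero]
    module
  rw [h]
  exact S.mul_mem (S.mul_mem (S.mul_mem (S.mul_mem (hA 1) (hB 1)) (hA (-1))) (hB (-1))) (hB (u k))

theorem one_add_vecMulVec_add_mem {u w w' : Fin 3 → R} (hwu : w ⬝ᵥ u = 0)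
    (hw : 1 + vecMulVec u w ∈ S) (hw' : 1 + vecMulVec u w' ∈ S) :
    1 + vecMulVec u (w + w') ∈ S := by
  have h : 1 + vecMulVec u (w + w') = (1 + vecMulVec u w) * (1 + vecMulVec u w') := by
    rw [add_mul, mul_add, mul_add, vecMulVec_mul_vecMulVec, hwu, vecMulVec_add]
    simp
    abel
  rw [h]
  exact S.mul_mem hw hw'

theorem one_add_vecMulVec_cross_mem (hS : ∀ i j, i ≠ j → ∀ t, transvection i j t ∈ S)
    (u c : Fin 3 → R) : 1 + vecMulVec u (crossProduct u c) ∈ S := by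
  have hdot (c : Fin 3 → R) : crossProduct u c ⬝ᵥ u = 0 := by
    rw [dotProduct_comm, dot_self_cross]
  have hmem (k : Fin 3) : 1 + vecMulVec u (crossProduct u (Pi.single k (c k))) ∈ S := by
    refine one_add_vecMulVec_mem_of_apply_eq_zero hS (k := k) ?_ (hdot _)
    fin_cases k <;> simp [cross_apply]
  have hc : c = Pi.single 0 (c 0) + (Pi.single 1 (c 1) + Pi.single 2 (c 2)) := by
    ext k
    fin_cases k <;> simp
  rw [hc, map_add, map_add]
  exact one_add_vecMulVec_add_mem (hdot _) (hmem 0)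
    (one_add_vecMulVec_add_mem (hdot _) (hmem 1) (hmem 2))

/-- Suslin's normality theorem in rank three: conjugates of elementary matrices are products of
elementary matrices. -/
theorem conj_transvection_mem (hS : ∀ i j, i ≠ j → ∀ t, transvection i j t ∈ S)
    (g : GL (Fin 3) R) {i j : Fin 3} (hij : i ≠ j) (t : R) :
    g.val * transvection i j t * g⁻¹.val ∈ S := by
  set u : Fin 3 → R := g.val.col i with hu
  have hdot (k : Fin 3) : g⁻¹.val.row k ⬝ᵥ u = (1 : Matrix (Fin 3) (Fin 3) R) k i := by
    rw [← Units.inv_mul g, Matrix.mul_apply]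
    rfl
  have hcross : t • g⁻¹.val.row j =
      crossProduct u (crossProduct (t • g⁻¹.val.row j) (g⁻¹.val.row i)) := by
    have h1 := hdot i
    have h2 := hdot j
    rw [one_apply_eq] at h1
    rw [one_apply_ne hij.symm] at h2
    generalize g⁻¹.val.row j = v at *
    generalize g⁻¹.val.row i = p at *
    simp only [dotProduct, Fin.sum_univ_three] at h1 h2
    ext k
    fin_cases k <;> simp [cross_apply]
    · linear_combination (-t * v 0) * h1 + t * p 0 * h2
    · linear_combination (-t * v 1) * h1 + t * p 1 * h2
    · linear_combination (-t * v 2) * h1 + t * p 2 * h2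
  have h : g.val * transvection i j t * g⁻¹.val = 1 + vecMulVec u (t • g⁻¹.val.row j) := by
    rw [transvection, Matrix.mul_add, Matrix.add_mul, Matrix.mul_one, Units.mul_inv]
    congr 1
    ext k l
    simp [-coe_units_inv, Matrix.mul_apply, vecMulVec, hu, single, Fin.sum_univ_three]
    fin_cases i <;> fin_cases j <;> simp <;> ring
  rw [h, hcross]
  exact one_add_vecMulVec_cross_mem hS _ _

end Transvections

/-! ### Rigidity -/

theorem diag_conj_sgn (d : Fin 3 → Rˣ) (i : Fin 3) : diag d * sgn i * (diag d)⁻¹ = sgn i := by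
  rw [mul_inv_eq_iff_eq_mul]
  exact diag_mul_comm _ _

theorem diag_conj_cyc {μ : Rˣ} (h3 : μ ^ 3 = 1) :
    diag ![1, μ, μ ^ 2] * cyc * (diag ![1, μ, μ ^ 2])⁻¹ =
      GeneralLinearGroup.scalar (Fin 3) μ * cyc := by
  have h3' : (μ : R) * μ ^ 2 = 1 := by
    rw [← pow_succ', ← Units.val_pow_eq_pow_val, h3, Units.val_one]
  rw [mul_inv_eq_iff_eq_mul]
  ext k l
  rw [mul_assoc, coe_scalar_mul]
  fin_cases k <;> fin_cases l <;> simp [diag, cyc, vecMul_diagonal, h3']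
  ring

theorem diag_conj_elem01 {μ : Rˣ} :
    diag ![1, μ, μ ^ 2] * elem01 (μ : R) * (diag ![1, μ, μ ^ 2])⁻¹ = elem01 1 := by
  rw [mul_inv_eq_iff_eq_mul]
  ext k l
  fin_cases k <;> fin_cases l <;> simp [diag, elem01]

theorem mem_center_of_commute_transvection {y : GL (Fin 3) R}
    (hy : ∀ i j, i ≠ j → ∀ t, Commute (transvection i j t) y.val) :
    y ∈ Subgroup.center (GL (Fin 3) R) := by
  rw [GeneralLinearGroup.mem_center_iff_val_mem_range_scalar]
  refine mem_range_scalar_of_commute_single fun i j hij => ?_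
  have h := (hy i j hij 1).sub_left (Commute.one_left _)
  rwa [transvection, add_sub_cancel_left] at h

/-- A class-preserving endomorphism fixing the signs, the cyclic permutation and one elementary
matrix is the identity. -/
theorem IsClassPreserving.eq_self (h2 : IsUnit (2 : R)) {φ : PGL3 R →* PGL3 R}
    (hφ : IsClassPreserving φ) (hs : ∀ i, φ (proj (sgn i)) = proj (sgn i))
    (hc : φ (proj cyc) = proj cyc) (h1 : φ (proj (elem01 1)) = proj (elem01 1)) (g : PGL3 R) :
    φ g = g := by
  have he (t : R) : φ (proj (elem01 t)) = proj (elem01 t) := by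
    obtain ⟨μ, -, hμ⟩ := hφ.exists_elem01 h2 hs hc t
    exact hφ.fix_elem01 hc h1 hμ
  obtain ⟨F, hF⟩ : ∃ F : Subgroup (GL (Fin 3) R), ∀ x, x ∈ F ↔ φ (proj x) = proj x :=
    ⟨(φ.comp proj).eqLocus proj, fun _ => Iff.rfl⟩
  have hx (n : ℕ) (t : R) : cyc ^ n * elem01 t * (cyc ^ n)⁻¹ ∈ F :=
    F.mul_mem (F.mul_mem (F.pow_mem ((hF _).mpr hc) n) ((hF _).mpr (he t)))
      (F.inv_mem (F.pow_mem ((hF _).mpr hc) n))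
  have htrans (i j : Fin 3) (hij : i ≠ j) (t : R) :
      transvection i j t ∈ F.toSubmonoid.map (Units.coeHom _) :=
    exists_mem_eq_transvection hx hij t
  obtain ⟨g, rfl⟩ := QuotientGroup.mk'_surjective _ g
  obtain ⟨h, hh⟩ := QuotientGroup.mk'_surjective _ (φ (proj g))
  have hcomm (n : ℕ) (t : R) :
      cyc ^ n * elem01 t * (cyc ^ n)⁻¹ ∈ Subgroup.centralizer {g⁻¹ * h} := by
    obtain ⟨i, j, hij, hv⟩ : ∃ i j : Fin 3, i ≠ j ∧
        (cyc ^ n * elem01 t * (cyc ^ n)⁻¹).val = transvection i j t :=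
      ⟨_, _, by simp, coe_cyc_pow_conj (coe_elem01 t) n⟩
    have hxn := (hF _).mp (hx n t)
    have hg : φ (proj (g * (cyc ^ n * elem01 t * (cyc ^ n)⁻¹) * g⁻¹)) =
        proj (g * (cyc ^ n * elem01 t * (cyc ^ n)⁻¹) * g⁻¹) := by
      obtain ⟨z, hz, hzv⟩ := conj_transvection_mem htrans g hij t
      rw [← hF, ← show z = g * (cyc ^ n * elem01 t * (cyc ^ n)⁻¹) * g⁻¹ from Units.ext ?_]
      · exact hz
      · rw [Units.val_mul, Units.val_mul, hv]
        exact hzv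
    have hy : proj (g⁻¹ * h * (cyc ^ n * elem01 t * (cyc ^ n)⁻¹) * (g⁻¹ * h)⁻¹) =
        proj (cyc ^ n * elem01 t * (cyc ^ n)⁻¹) := by
      generalize cyc ^ n * elem01 t * (cyc ^ n)⁻¹ = x at hg hxn
      have hgh : proj (h * x * h⁻¹) = proj (g * x * g⁻¹) := by
        rw [← hg]
        simp only [map_mul φ, map_mul proj, map_inv, hxn, hh]
      calc proj (g⁻¹ * h * x * (g⁻¹ * h)⁻¹) = proj (g⁻¹ * (h * x * h⁻¹) * g) := by
            congr 1
            group
        _ = proj (g⁻¹ * (g * x * g⁻¹) * g) := by rw [map_mul, map_mul, hgh, ← map_mul, ← map_mul]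
        _ = proj x := by
            congr 1
            group
    rw [Subgroup.mem_centralizer_singleton_iff]
    exact (mul_inv_eq_iff_eq_mul.mp (conj_elem01_eq_of_proj_eq hy (.inl rfl))).symm
  have hcenter : g⁻¹ * h ∈ Subgroup.center (GL (Fin 3) R) := by
    refine mem_center_of_commute_transvection fun i j hij t => ?_
    obtain ⟨x, hx, hxv⟩ := exists_mem_eq_transvection hcomm hij t
    rw [Subgroup.mem_centralizer_singleton_iff] at hx
    rw [← hxv, Commute, SemiconjBy, ← Units.val_mul, ← Units.val_mul, hx]
  rw [← hh]
  exact (QuotientGroup.eq.mpr hcenter).symm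

theorem IsClassPreserving.isInner_of_fix_cyc (h2 : IsUnit (2 : R)) {φ : PGL3 R →* PGL3 R}
    (hφ : IsClassPreserving φ) (hs : ∀ i, φ (proj (sgn i)) = proj (sgn i))
    (hc : φ (proj cyc) = proj cyc) : IsInner φ := by
  obtain ⟨μ, h3, hμ⟩ := hφ.exists_elem01 h2 hs hc 1
  refine IsInner.of_conj_comp (proj (diag ![1, μ, μ ^ 2])) ⟨1, fun g => ?_⟩
  rw [one_mul, inv_one, mul_one]
  refine (hφ.conj_comp _).eq_self h2 (fun i => ?_) ?_ ?_ g
  · rw [conj_comp_proj (hs i), diag_conj_sgn]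
  · rw [conj_comp_proj hc, diag_conj_cyc h3, proj_scalar_mul]
  · rw [conj_comp_proj hμ, mul_one, diag_conj_elem01]

theorem IsClassPreserving.isInner_of_fix_sgn (h2 : IsUnit (2 : R)) {φ : PGL3 R →* PGL3 R}
    (hφ : IsClassPreserving φ) (hs : ∀ i, φ (proj (sgn i)) = proj (sgn i)) : IsInner φ := by
  obtain ⟨d, hd⟩ := hφ.exists_conj_cyc h2 hs
  refine IsInner.of_conj_comp (proj (diag d)⁻¹)
    ((hφ.conj_comp _).isInner_of_fix_cyc h2 (fun i => ?_) ?_)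
  · rw [conj_comp_proj (hs i)]
    congr 1
    conv_lhs => rw [← diag_conj_sgn d i]
    group
  · rw [conj_comp_proj hd]
    congr 1
    group

theorem IsClassPreserving.isInner (h2 : IsUnit (2 : R)) {φ : PGL3 R →* PGL3 R}
    (hφ : IsClassPreserving φ) : IsInner φ := by
  obtain ⟨P, hP⟩ := hφ.exists_conj_sgn h2
  refine IsInner.of_conj_comp (proj P⁻¹) ((hφ.conj_comp _).isInner_of_fix_sgn h2 fun i => ?_)
  rw [conj_comp_proj (hP i)]
  congr 1
  group

end PGL3

/-- Every class-preserving endomorphism of `PGL₃(R)` is inner, provided `2 ∈ R^×`. -/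
theorem classPreserving_endomorphism_isInner_PGL3
    {R : Type*} [CommRing R] (h2 : IsUnit (2 : R))
    (φ : PGL3 R →* PGL3 R)
    (hcp : ∀ g : PGL3 R, ∃ y : PGL3 R, φ g = y * g * y⁻¹) :
    ∃ y : PGL3 R, ∀ g : PGL3 R, φ g = y * g * y⁻¹ := by
  exact PGL3.IsClassPreserving.isInner h2 hcp
end

section
/- Let K be a field in which 7 ≠ 0. Set Y = [[0, 1, 2], [0, 1, 1], [−1, 0, 0]] and Y' = [[0, 0, −1], [1, 2, 0], [1, 1, 0]], both invertible 3×3 matrices over K. Then there exist no g ∈ GL₃(K) and λ ∈ K such that g·Y·g⁻¹ = λ·Y'. In particular, the images of Y and Y' in PGL₃(K) (the quotient of GL₃(K) by its center) are not conjugate. -/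
open Matrix

/-- If `7 ≠ 0` in a field `K`, then the matrices
`Y = [[0,1,2],[0,1,1],[−1,0,0]]` and `Y' = [[0,0,−1],[1,2,0],[1,1,0]]`
are not conjugate up to a scalar: there are no `g ∈ GL₃(K)` and `λ ∈ K` with
`g·Y·g⁻¹ = λ·Y'`.  In particular the images of `Y` and `Y'` in `PGL₃(K)` are
not conjugate. -/
theorem not_conj_smul_A2_graph_aut {K : Type*} [Field K] (h7 : (7 : K) ≠ 0) :
    ¬ ∃ (g : GL (Fin 3) K) (l : K),
      (g : Matrix (Fin 3) (Fin 3) K) * !![0, 1, 2; 0, 1, 1; -1, 0, 0] *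
        ((g⁻¹ : GL (Fin 3) K) : Matrix (Fin 3) (Fin 3) K)
          = l • !![0, 0, -1; 1, 2, 0; 1, 1, 0] := by
  rintro ⟨g, l, h⟩
  have htrace := congrArg Matrix.trace h
  have hdet := congrArg Matrix.det h
  rw [Matrix.trace_units_conj, Matrix.trace_smul] at htrace
  rw [Matrix.det_units_conj, Matrix.det_smul] at hdet
  simp [Matrix.trace_fin_three] at htrace
  simp [Matrix.det_fin_three] at hdet
  apply h7
  grind
end

section
/- Let R be a commutative ring in which 2 is invertible, and let a, h, d ∈ R. If the matrix B = [[a(1+hd), a·h, 0], [a·d, a, 0], [0, 0, a]] belongs to the elementary adjoint Chevalley group E(A₁,R) ≤ GL₃(R), then necessarily h = 0, d = 0 and a = 1; in other words, B must be the identity matrix. In particular, such a membership is impossible when h, d are nonzero and a ≠ 1. -/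
open Matrix

/-- The quadratic form `z² - xy` on `R³` preserved by the adjoint group of type A₁. -/
def adjointForm {R : Type*} [CommRing R] (v : Fin 3 → R) : R :=
  v 2 ^ 2 - v 0 * v 1

theorem adjointForm_xPlus_mulVec {R : Type*} [CommRing R] (t : R) (v : Fin 3 → R) :
    adjointForm (xPlus t *ᵥ v) = adjointForm v := by
  simp [adjointForm, xPlus, Matrix.mulVec, dotProduct, Fin.sum_univ_three]
  ring

theorem adjointForm_xMinus_mulVec {R : Type*} [CommRing R] (t : R) (v : Fin 3 → R) :
    adjointForm (xMinus t *ᵥ v) = adjointForm v := by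
  simp [adjointForm, xMinus, Matrix.mulVec, dotProduct, Fin.sum_univ_three]
  ring

theorem det_xPlus {R : Type*} [CommRing R] (t : R) : (xPlus t).det = 1 := by
  simp [xPlus, Matrix.det_fin_three]

theorem det_xMinus {R : Type*} [CommRing R] (t : R) : (xMinus t).det = 1 := by
  simp [xMinus, Matrix.det_fin_three]

theorem adjointForm_mulVec_of_mem_ElemA1 {R : Type*} [CommRing R] {g : GL (Fin 3) R}
    (hg : g ∈ ElemA1 R) (v : Fin 3 → R) :
    adjointForm ((g : Matrix (Fin 3) (Fin 3) R) *ᵥ v) = adjointForm v := by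
  induction hg using Subgroup.closure_induction generalizing v with
  | mem x hx =>
    obtain ⟨t, ht | ht⟩ := hx
    · rw [ht, adjointForm_xPlus_mulVec]
    · rw [ht, adjointForm_xMinus_mulVec]
  | one => simp
  | mul x y _ _ hx hy => rw [Units.val_mul, ← Matrix.mulVec_mulVec, hx, hy]
  | inv x _ hx => rw [← hx, Matrix.mulVec_mulVec, Units.mul_inv, Matrix.one_mulVec]

theorem det_eq_one_of_mem_ElemA1 {R : Type*} [CommRing R] {g : GL (Fin 3) R}
    (hg : g ∈ ElemA1 R) : (g : Matrix (Fin 3) (Fin 3) R).det = 1 := by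
  suffices h : ElemA1 R ≤ (Matrix.GeneralLinearGroup.det (n := Fin 3) (R := R)).ker from
    congrArg Units.val (h hg)
  refine (Subgroup.closure_le _).2 ?_
  rintro x ⟨t, ht | ht⟩ <;> refine Units.ext ?_
  · simp [ht, det_xPlus]
  · simp [ht, det_xMinus]

/-- If `2 ∈ R^×` and the matrix `B = [[a(1+hd), ah, 0],[ad, a, 0],[0,0,a]]` belongs to
`E(A₁,R)`, then `h = 0`, `d = 0` and `a = 1`, i.e. `B` is the identity matrix. -/
theorem block_matrix_in_ElemA1_impossible
    {R : Type*} [CommRing R] (h2 : IsUnit (2 : R)) (a h d : R)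
    (hB : ∃ g : GL (Fin 3) R, g ∈ ElemA1 R ∧
      (g : Matrix (Fin 3) (Fin 3) R) =
        !![a*(1 + h*d), a*h, 0; a*d, a, 0; 0, 0, a]) :
    h = 0 ∧ d = 0 ∧ a = 1 := by
  obtain ⟨g, hg, hgB⟩ := hB
  have hdet := det_eq_one_of_mem_ElemA1 hg
  have hform := adjointForm_mulVec_of_mem_ElemA1 hg
  rw [hgB] at hdet hform
  have e₁ := hform ![1, 0, 0]
  have e₂ := hform ![0, 1, 0]
  have e₃ := hform ![0, 0, 1]
  simp [adjointForm, Matrix.mulVec, dotProduct, Fin.sum_univ_three] at e₁ e₂ e₃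
  simp [Matrix.det_fin_three] at hdet
  have ha : a = 1 := by linear_combination hdet - a * e₃
  subst ha
  have hh : h = 0 := by linear_combination e₂
  subst hh
  exact ⟨rfl, by linear_combination e₁, rfl⟩
end

section
/- Let R be a commutative ring in which 2 is invertible, and let a, b ∈ R. If the matrix X = [[a, b², 2b], [0, a, 0], [0, b, a]] belongs to the elementary adjoint Chevalley group E(A₁,R) ≤ GL₃(R), then a = 1, i.e. X = x₊(b). -/
open Matrix

/-- If `2 ∈ R^×` and the matrix `X = [[a, b², 2b],[0, a, 0],[0, b, a]]` belongs to
`E(A₁,R)`, then `a = 1`, i.e. `X = x₊(b)`. -/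
theorem diagonal_param_eq_one_of_mem_ElemA1
    {R : Type*} [CommRing R] (h2 : IsUnit (2 : R)) (a b : R)
    (hX : ∃ g : GL (Fin 3) R, g ∈ ElemA1 R ∧
      (g : Matrix (Fin 3) (Fin 3) R) = !![a, b^2, 2*b; 0, a, 0; 0, b, a]) :
    a = 1 := by
  obtain ⟨g, hg, hgX⟩ := hX
  have hdet := det_eq_one_of_mem_ElemA1 hg
  have hform := adjointForm_mulVec_of_mem_ElemA1 hg ![0, 0, 1]
  simp [hgX, det_fin_three] at hdet
  simp [hgX, adjointForm, mulVec, dotProduct, Fin.sum_univ_three] at hform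
  linear_combination hdet - a * hform
end

section
/- Let R be a commutative ring in which 2 is invertible, and let ρ : R → R be an additive group homomorphism with ρ(1) = 1 such that ρ(t)² − 6·ρ(t) + 8 = t² − 6·t + 8 for all t ∈ R. Then ρ(t) = t for all t ∈ R. -/
/-- If `2 ∈ R^×` and an additive endomorphism `ρ` of `R` with `ρ(1) = 1` satisfies
`ρ(t)² − 6ρ(t) + 8 = t² − 6t + 8` for all `t`, then `ρ = id`. -/
theorem additive_hom_preserving_trace_poly_A2_is_id
    {R : Type*} [CommRing R] (h2 : IsUnit (2 : R))
    (ρ : R →+ R) (hρ1 : ρ 1 = 1)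
    (h : ∀ t : R, ρ t ^ 2 - 6 * ρ t + 8 = t ^ 2 - 6 * t + 8) :
    ∀ t : R, ρ t = t := by
  intro t
  have h_add := h (t + 1)
  rw [map_add, hρ1] at h_add
  exact h2.mul_left_cancel (by linear_combination h_add - h t)
end
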